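/- Let ξ ∈ ℝ with 0 < ξ < α and Λ G(ξ) > λ G(α), and let u ∈ C²([0,R)) be the solution of the Cauchy problem M⁺(u'') + g(u) = 0, u(0) = ξ, u'(0) = 0 on its maximal interval of existence [0,R). Then u is strictly decreasing on (0,R) and u(r) → −∞ as r → R⁻. -/

import Mathlib

open Set Filter Topology

/-- The inverse of the one-dimensional Pucci maximal operator `x ↦ Λ x⁺ - λ x⁻`, conjugated by
`x ↦ -x`. -/
noncomputable def pucciInv (lam Lam y : ℝ) : ℝ := max y 0 / lam + min y 0 / Lam

theorem pucciInv_of_nonneg {lam Lam y : ℝ} (hy : 0 ≤ y) : pucciInv lam Lam y = y / lam := by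
  simp [pucciInv, hy]

theorem pucciInv_of_nonpos {lam Lam y : ℝ} (hy : y ≤ 0) : pucciInv lam Lam y = y / Lam := by
  simp [pucciInv, hy]

theorem continuous_pucciInv (lam Lam : ℝ) : Continuous (pucciInv lam Lam) := by
  unfold pucciInv
  fun_prop

theorem pucci_add_eq_zero_iff {lam Lam : ℝ} (hlam : 0 < lam) (hLam : 0 < Lam) (x y : ℝ) :
    (if 0 ≤ x then Lam * x else lam * x) + y = 0 ↔ x = -pucciInv lam Lam y := by
  rcases le_or_gt 0 x with hx | hx
  · rw [if_pos hx]
    constructor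
    · intro h
      have hy : y ≤ 0 := by nlinarith
      rw [pucciInv_of_nonpos hy]
      field_simp
      linarith
    · intro h
      have hy : y ≤ 0 := by
        by_contra! hy
        have := div_pos hy hlam
        rw [pucciInv_of_nonneg hy.le] at h
        linarith
      rw [pucciInv_of_nonpos hy] at h
      field_simp at h
      linarith
  · rw [if_neg hx.not_ge]
    constructor
    · intro h
      have hy : 0 ≤ y := by nlinarith
      rw [pucciInv_of_nonneg hy]
      field_simp
      linarith
    · intro h
      have hy : 0 ≤ y := by
        by_contra! hy
        have := div_neg_of_neg_of_pos hy hLam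
        rw [pucciInv_of_nonpos hy.le] at h
        linarith
      rw [pucciInv_of_nonneg hy] at h
      field_simp at h
      linarith

/-- A solution of a scalar autonomous equation with a finite left limit at `ρ` extends past `ρ` if
the vector field is `C¹` near the limit. -/
theorem exists_extension_of_tendsto {φ u : ℝ → ℝ} {a ρ L : ℝ} {U : Set ℝ} (ha : a < ρ)
    (hu : ∀ r ∈ Ioo a ρ, HasDerivAt u (φ (u r)) r) (hL : Tendsto u (𝓝[<] ρ) (𝓝 L))
    (hφ : ContDiffAt ℝ 1 φ L) (hU : U ∈ 𝓝 L) :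
    ∃ ε > 0, ∃ v : ℝ → ℝ, (∀ r < ρ, v r = u r) ∧ (∀ r ∈ Ico ρ (ρ + ε), v r ∈ U) ∧
      ∀ r ∈ Ioo a (ρ + ε), HasDerivAt v (φ (v r)) r := by
  obtain ⟨w, hw0, ε₀, hε₀, hw⟩ :=
    hφ.exists_forall_mem_closedBall_exists_eq_forall_mem_Ioo_hasDerivAt₀ ρ
  have hwρ : HasDerivAt w (φ (w ρ)) ρ := hw ρ ⟨by linarith, by linarith⟩
  have hwU : ∀ᶠ r in 𝓝 ρ, w r ∈ U := hwρ.continuousAt (by rwa [hw0])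
  obtain ⟨ε₁, hε₁, hwU⟩ := Metric.eventually_nhds_iff.1 hwU
  set v : ℝ → ℝ := fun r => if r < ρ then u r else w r with hv
  have hvu : ∀ r < ρ, v r = u r := fun r hr => by simp [hv, hr]
  have hvw : ∀ r, ρ ≤ r → v r = w r := fun r hr => by simp [hv, hr.not_gt]
  have hvL : v ρ = L := (hvw ρ le_rfl).trans hw0
  have hleft : ∀ r ∈ Ioo a ρ, HasDerivAt v (φ (u r)) r := fun r hr =>
    (hu r hr).congr_of_eventuallyEq
      (by filter_upwards [Iio_mem_nhds hr.2] with s hs using hvu s hs)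
  have hIoo : Ioo a ρ ∈ 𝓝[<] ρ := Ioo_mem_nhdsLT ha
  refine ⟨min ε₀ ε₁, lt_min hε₀ hε₁, v, hvu, fun r hr => ?_, fun r hr => ?_⟩
  · rw [hvw r hr.1]
    apply hwU
    rw [Real.dist_eq, abs_lt]
    have := min_le_right ε₀ ε₁
    constructor <;> linarith [hr.1, hr.2]
  have hr2 : r < ρ + ε₀ := hr.2.trans_le (by linarith [min_le_left ε₀ ε₁])
  rcases lt_trichotomy r ρ with h | rfl | h
  · rw [hvu r h]
    exact hleft r ⟨hr.1, h⟩
  · have h1 : HasDerivWithinAt v (φ L) (Iic r) r := by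
      apply hasDerivWithinAt_Iic_of_tendsto_deriv (s := Ioo a r)
      · exact fun s hs => (hleft s hs).differentiableAt.differentiableWithinAt
      · have : Tendsto v (𝓝[Ioo a r] r) (𝓝 L) := by
          refine (hL.mono_left (nhdsWithin_mono _ Ioo_subset_Iio_self)).congr' ?_
          filter_upwards [self_mem_nhdsWithin] with s hs using (hvu s hs.2).symm
        rwa [← hvL] at this
      · exact hIoo
      · refine (hφ.continuousAt.tendsto.comp hL).congr' ?_
        filter_upwards [hIoo] with s hs using (hleft s hs).deriv.symm
    have h2 : HasDerivWithinAt v (φ L) (Ici r) r := by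
      rw [hw0] at hwρ
      exact hwρ.hasDerivWithinAt.congr (fun s hs => hvw s hs) (hvw r le_rfl)
    rw [hvL]
    have := h1.union h2
    rwa [Iic_union_Ici, hasDerivWithinAt_univ] at this
  · rw [hvw r h.le]
    exact (hw r ⟨by linarith, hr2⟩).congr_of_eventuallyEq
      (by filter_upwards [Ioi_mem_nhds h] with s hs using hvw s hs.le)

/-- First-order reduction of `v'' = -f(v)` at energy level `E`: a solution of
`v' = -√(2 (E - P(v)))`, where `P' = f`, solves the second-order equation. -/
theorem contDiffOn_two_of_hasDerivAt_neg_sqrt {P f v : ℝ → ℝ} {E : ℝ} {s : Set ℝ} (hs : IsOpen s)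
    (hP : ∀ t, HasDerivAt P (f t) t) (hf : Continuous f) (hv : ∀ r ∈ s, P (v r) < E)
    (hdv : ∀ r ∈ s, HasDerivAt v (-√(2 * (E - P (v r)))) r) :
    ContDiffOn ℝ 2 v s ∧ ∀ r ∈ s, deriv (deriv v) r = -f (v r) := by
  have hderiv : ∀ r ∈ s, HasDerivAt (deriv v) (-f (v r)) r := by
    intro r hr
    have hpos : 0 < 2 * (E - P (v r)) := by linarith [hv r hr]
    have hsq : √(2 * (E - P (v r))) ≠ 0 := (Real.sqrt_pos.2 hpos).ne'
    have h1 := (((((hP (v r)).comp r (hdv r hr)).const_sub E).const_mul 2).sqrt hpos.ne').neg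
    refine (h1.congr_of_eventuallyEq ?_).congr_deriv ?_
    · filter_upwards [hs.mem_nhds hr] with q hq using (hdv q hq).deriv
    · simp only [Function.comp_apply]
      field_simp
  refine ⟨?_, fun r hr => (hderiv r hr).deriv⟩
  have hvc : ContinuousOn v s := fun r hr => (hdv r hr).continuousAt.continuousWithinAt
  rw [show (2 : WithTop ℕ∞) = 1 + 1 by norm_num, contDiffOn_succ_iff_deriv_of_isOpen hs]
  refine ⟨fun r hr => (hdv r hr).differentiableAt.differentiableWithinAt, by simp, ?_⟩
  rw [show (1 : WithTop ℕ∞) = 0 + 1 by norm_num, contDiffOn_succ_iff_deriv_of_isOpen hs]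
  refine ⟨fun r hr => (hderiv r hr).differentiableAt.differentiableWithinAt, by simp, ?_⟩
  rw [contDiffOn_zero]
  exact (hf.comp_continuousOn hvc).neg.congr fun r hr => (hderiv r hr).deriv

theorem energy_eq {P f u d : ℝ → ℝ} {b : ℝ} (hP : ∀ t, HasDerivAt P (f t) t)
    (hu : ContinuousOn u (Icc 0 b)) (hd : ∀ r ∈ Ioc 0 b, HasDerivAt u (d r) r)
    (hdd : ∀ r ∈ Icc 0 b, HasDerivAt d (-f (u r)) r) (hd0 : d 0 = 0) (hb : 0 < b) :
    d b ^ 2 / 2 + P (u b) = P (u 0) := by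
  have hPc : Continuous P := continuous_iff_continuousAt.2 fun t => (hP t).continuousAt
  have hdc : ContinuousOn d (Icc 0 b) := fun r hr => (hdd r hr).continuousAt.continuousWithinAt
  obtain ⟨c, hc, hslope⟩ := exists_hasDerivAt_eq_slope (fun r => d r ^ 2 / 2 + P (u r))
    (fun _ => 0) hb (((hdc.pow 2).div_const 2).add (hPc.comp_continuousOn hu))
    (fun r hr => by
      have h1 := ((hdd r (Ioo_subset_Icc_self hr)).pow 2).div_const 2
      have h2 := (hP (u r)).comp r (hd r (Ioo_subset_Ioc_self hr))
      refine (h1.add h2).congr_deriv ?_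
      push_cast
      ring)
  have : b - 0 ≠ 0 := by linarith
  rw [eq_div_iff this] at hslope
  simp only [hd0] at hslope
  linarith

theorem velocity_neg {P f u d : ℝ → ℝ} {b : ℝ} (hP : ∀ t, HasDerivAt P (f t) t)
    (hlt : ∀ t < u 0, P t < P (u 0)) (hf0 : 0 < f (u 0))
    (hu : ContinuousOn u (Icc 0 b)) (hd : ∀ r ∈ Ioc 0 b, HasDerivAt u (d r) r)
    (hdd : ∀ r ∈ Icc 0 b, HasDerivAt d (-f (u r)) r) (hd0 : d 0 = 0) (hb : 0 < b) :
    d b < 0 := by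
  by_contra! hdb
  have hdc : ContinuousOn d (Icc 0 b) := fun r hr => (hdd r hr).continuousAt.continuousWithinAt
  have hnear : ∀ᶠ r in 𝓝[>] (0 : ℝ), d r < 0 := by
    have h := (hasDerivWithinAt_iff_tendsto_slope' (lt_irrefl (0 : ℝ))).1
      ((hdd 0 ⟨le_rfl, hb.le⟩).hasDerivWithinAt (s := Ioi 0))
    filter_upwards [h.eventually (Iio_mem_nhds (by linarith : -f (u 0) < 0)),
      self_mem_nhdsWithin] with r hr hr0
    rw [slope_def_field, hd0, sub_zero, sub_zero] at hr
    have hr0 : 0 < r := hr0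
    by_contra! hdr
    exact absurd hr (not_lt.2 (div_nonneg hdr hr0.le))
  obtain ⟨δ, hδ0, hδ⟩ := (mem_nhdsGT_iff_exists_Ioo_subset).1 hnear
  have hδ0 : 0 < δ := hδ0
  have hδb : δ ≤ b := by
    by_contra! h
    exact absurd (hδ ⟨hb, h⟩ : d b < 0) hdb.not_gt
  have hK : IsCompact (Icc δ b ∩ d ⁻¹' Ici 0) :=
    isCompact_Icc.of_isClosed_subset
      ((hdc.mono (Icc_subset_Icc_left hδ0.le)).preimage_isClosed_of_isClosed isClosed_Icc
        isClosed_Ici) inter_subset_left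
  obtain ⟨c, ⟨⟨hcδ, hcb⟩, hdc0⟩, hmin⟩ := hK.exists_isLeast ⟨b, ⟨hδb, le_rfl⟩, hdb⟩
  have hc0 : 0 < c := hδ0.trans_le hcδ
  have hdc0 : 0 ≤ d c := hdc0
  have hneg : ∀ r ∈ Ioo 0 c, d r < 0 := by
    intro r hr
    rcases lt_or_ge r δ with h | h
    · exact hδ ⟨hr.1, h⟩
    · by_contra! h'
      exact absurd (hmin ⟨⟨h, hr.2.le.trans hcb⟩, h'⟩) hr.2.not_ge
  have hdc_eq : d c = 0 := by
    refine le_antisymm ?_ hdc0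
    have hcont : Tendsto d (𝓝[<] c) (𝓝 (d c)) :=
      (hdd c ⟨hc0.le, hcb⟩).continuousAt.continuousWithinAt
    refine le_of_tendsto hcont ?_
    filter_upwards [Ioo_mem_nhdsLT hc0] with r hr using (hneg r hr).le
  have hanti : StrictAntiOn u (Icc 0 c) := by
    refine strictAntiOn_of_deriv_neg (convex_Icc 0 c) (hu.mono (Icc_subset_Icc_right hcb)) ?_
    intro r hr
    rw [interior_Icc] at hr
    rw [(hd r ⟨hr.1, hr.2.le.trans hcb⟩).deriv]
    exact hneg r hr
  have huc : u c < u 0 := hanti ⟨le_rfl, hc0.le⟩ ⟨hc0.le, le_rfl⟩ hc0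
  have hE := energy_eq hP (hu.mono (Icc_subset_Icc_right hcb))
    (fun r hr => hd r ⟨hr.1, hr.2.trans hcb⟩) (fun r hr => hdd r ⟨hr.1, hr.2.trans hcb⟩) hd0 hc0
  rw [hdc_eq] at hE
  linarith [hlt _ huc]

theorem hasDerivAt_integral_pucciInv {g : ℝ → ℝ} (hg : Continuous g) (lam Lam t : ℝ) :
    HasDerivAt (fun t => ∫ s in (0 : ℝ)..t, pucciInv lam Lam (g s)) (pucciInv lam Lam (g t)) t :=
  ((continuous_pucciInv lam Lam).comp hg).integral_hasStrictDerivAt 0 t |>.hasDerivAt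

/-- The weighted potential stays below its value at `ξ` on `(-∞, ξ)`. -/
theorem integral_pucciInv_lt {lam Lam α ξ : ℝ} {g : ℝ → ℝ} (hlam : 0 < lam) (hLam : 0 < Lam)
    (hg : Continuous g) (hodd : ∀ t, g (-t) = -g t) (hα : 0 < α)
    (hpos : ∀ t, 0 < t → t < α → 0 < g t) (hneg : ∀ t, α < t → g t < 0)
    (hξ0 : 0 < ξ) (hξα : ξ < α)
    (hlt : lam * ∫ s in (0 : ℝ)..α, g s < Lam * ∫ s in (0 : ℝ)..ξ, g s) (t : ℝ) (ht : t < ξ) :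
    ∫ s in (0 : ℝ)..t, pucciInv lam Lam (g s) < ∫ s in (0 : ℝ)..ξ, pucciInv lam Lam (g s) := by
  set P : ℝ → ℝ := fun t => ∫ s in (0 : ℝ)..t, pucciInv lam Lam (g s) with hPdef
  have hP : ∀ t, HasDerivAt P (pucciInv lam Lam (g t)) t := hasDerivAt_integral_pucciInv hg lam Lam
  have hPc : Continuous P := continuous_iff_continuousAt.2 fun t => (hP t).continuousAt
  change P t < P ξ
  have hmono : StrictMonoOn P (Icc 0 ξ) := by
    refine strictMonoOn_of_deriv_pos (convex_Icc 0 ξ) hPc.continuousOn fun r hr => ?_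
    rw [interior_Icc] at hr
    have := hpos r hr.1 (hr.2.trans hξα)
    rw [(hP r).deriv, pucciInv_of_nonneg this.le]
    positivity
  rcases lt_or_ge 0 t with h0 | h0
  · exact hmono ⟨h0.le, ht.le⟩ ⟨hξ0.le, le_rfl⟩ ht
  have hPξ : P ξ = (∫ s in (0 : ℝ)..ξ, g s) / lam := by
    rw [hPdef, ← intervalIntegral.integral_div]
    apply intervalIntegral.integral_congr_uIoo
    intro s hs
    rw [uIoo_of_le hξ0.le] at hs
    exact pucciInv_of_nonneg (hpos s hs.1 (hs.2.trans hξα)).le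
  have hgneg : ∀ s ∈ Ioo (-α) 0, g s ≤ 0 := by
    intro s hs
    have := hpos (-s) (by linarith [hs.2]) (by linarith [hs.1])
    rw [hodd] at this
    linarith
  have hPα : P (-α) = (∫ s in (0 : ℝ)..α, g s) / Lam := by
    have h1 : P (-α) = (∫ s in (0 : ℝ)..(-α), g s) / Lam := by
      rw [hPdef, ← intervalIntegral.integral_div]
      apply intervalIntegral.integral_congr_uIoo
      intro s hs
      rw [uIoo_of_ge (neg_nonpos.2 hα.le)] at hs
      exact pucciInv_of_nonpos (hgneg s hs)
    have h2 := intervalIntegral.integral_comp_neg (f := g) (a := 0) (b := α)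
    simp only [hodd, intervalIntegral.integral_neg, neg_zero] at h2
    rw [h1, intervalIntegral.integral_symm, ← h2, neg_neg]
  have hlt' : P (-α) < P ξ := by
    rw [hPα, hPξ, div_lt_div_iff₀ hLam hlam]
    linarith
  refine lt_of_le_of_lt ?_ hlt'
  rcases le_or_gt (-α) t with hαt | hαt
  · have hanti : AntitoneOn P (Icc (-α) 0) := by
      refine antitoneOn_of_deriv_nonpos (convex_Icc _ _) hPc.continuousOn
        (fun r _ => (hP r).differentiableAt.differentiableWithinAt) fun r hr => ?_
      rw [interior_Icc] at hr
      rw [(hP r).deriv, pucciInv_of_nonpos (hgneg r hr)]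
      exact div_nonpos_of_nonpos_of_nonneg (hgneg r hr) hLam.le
    exact hanti ⟨le_rfl, by linarith⟩ ⟨hαt, h0⟩ hαt
  · have hmono' : MonotoneOn P (Iic (-α)) := by
      refine monotoneOn_of_deriv_nonneg (convex_Iic _) hPc.continuousOn
        (fun r _ => (hP r).differentiableAt.differentiableWithinAt) fun r hr => ?_
      rw [interior_Iic] at hr
      have h := hneg (-r) (by linarith [mem_Iio.1 hr])
      rw [hodd] at h
      have h : 0 ≤ g r := by linarith
      rw [(hP r).deriv, pucciInv_of_nonneg h]
      exact div_nonneg h hlam.le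
    exact hmono' hαt.le self_mem_Iic hαt.le

theorem pucci_1d_plus_blowdown_case
    (lam Lam : ℝ) (hlam : 0 < lam) (hlamLam : lam ≤ Lam)
    (g : ℝ → ℝ) (hg1 : LocallyLipschitz g)
    (hg2 : ∀ t, g (-t) = - g t)
    (α : ℝ) (hα : 0 < α)
    (hg3pos : ∀ t, 0 < t → t < α → 0 < g t)
    (hg3neg : ∀ t, α < t → g t < 0)
    (G : ℝ → ℝ) (hG : ∀ t, G t = ∫ s in (0:ℝ)..t, g s)
    (ξ : ℝ) (hξ0 : 0 < ξ) (hξα : ξ < α)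
    (hGgt : lam * G α < Lam * G ξ)
    (R : EReal) (hR : 0 < R)
    (u : ℝ → ℝ)
    (hu : ContDiffOn ℝ 2 u {r : ℝ | 0 ≤ r ∧ (r : EReal) < R})
    (hode : ∀ r : ℝ, 0 ≤ r → (r : EReal) < R →
      (if 0 ≤ deriv (deriv u) r then Lam * deriv (deriv u) r
        else lam * deriv (deriv u) r) + g (u r) = 0)
    (hu0 : u 0 = ξ) (hu'0 : deriv u 0 = 0)
    (hmax : ¬ ∃ (R' : EReal) (v : ℝ → ℝ), R < R' ∧
      ContDiffOn ℝ 2 v {r : ℝ | 0 ≤ r ∧ (r : EReal) < R'} ∧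
      (∀ r : ℝ, 0 ≤ r → (r : EReal) < R' →
        (if 0 ≤ deriv (deriv v) r then Lam * deriv (deriv v) r
        else lam * deriv (deriv v) r) + g (v r) = 0) ∧
      v 0 = ξ ∧ deriv v 0 = 0 ∧
      (∀ r : ℝ, 0 ≤ r → (r : EReal) < R → v r = u r))
 :
    StrictAntiOn u {r : ℝ | 0 < r ∧ (r : EReal) < R} ∧
    Tendsto u (comap (fun r : ℝ => (r : EReal)) (𝓝[<] R)) atBot := by
  have hLam : 0 < Lam := hlam.trans_le hlamLam
  have hgc : Continuous g := hg1.continuous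
  set f : ℝ → ℝ := fun t => pucciInv lam Lam (g t) with hf
  set P : ℝ → ℝ := fun t => ∫ s in (0 : ℝ)..t, pucciInv lam Lam (g s) with hPdef
  have hfc : Continuous f := (continuous_pucciInv lam Lam).comp hgc
  have hP : ∀ t, HasDerivAt P (f t) t := hasDerivAt_integral_pucciInv hgc lam Lam
  have hPc : Continuous P := continuous_iff_continuousAt.2 fun t => (hP t).continuousAt
  rw [hG, hG] at hGgt
  have hlt : ∀ t < ξ, P t < P ξ :=
    integral_pucciInv_lt hlam hLam hgc hg2 hα hg3pos hg3neg hξ0 hξα hGgt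
  have hfξ : 0 < f ξ := by
    have := hg3pos ξ hξ0 hξα
    rw [hf]
    simp only [pucciInv_of_nonneg this.le]
    positivity
  have hode' : ∀ r : ℝ, 0 ≤ r → (r : EReal) < R → deriv (deriv u) r = -f (u r) :=
    fun r hr hrR => (pucci_add_eq_zero_iff hlam hLam _ _).1 (hode r hr hrR)
  have hopen : ∀ Q : EReal, IsOpen {r : ℝ | (r : EReal) < Q} := fun Q =>
    isOpen_Iio.preimage continuous_coe_real_ereal
  have hlower : ∀ {r s : ℝ}, r ≤ s → (s : EReal) < R → (r : EReal) < R := fun h hs =>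
    (EReal.coe_le_coe_iff.2 h).trans_lt hs
  have hTopen : IsOpen (Ioi (0 : ℝ) ∩ {r : ℝ | (r : EReal) < R}) := isOpen_Ioi.inter (hopen R)
  have huT : ContDiffOn ℝ 2 u (Ioi (0 : ℝ) ∩ {r : ℝ | (r : EReal) < R}) :=
    hu.mono fun r hr => ⟨le_of_lt hr.1, hr.2⟩
  rw [show (2 : WithTop ℕ∞) = 1 + 1 by norm_num,
    contDiffOn_succ_iff_deriv_of_isOpen hTopen] at huT
  have hd : ∀ r : ℝ, 0 < r → (r : EReal) < R → HasDerivAt u (deriv u r) r := fun r hr hrR =>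
    (huT.1.differentiableAt (hTopen.mem_nhds ⟨hr, hrR⟩)).hasDerivAt
  have hdd : ∀ r : ℝ, 0 ≤ r → (r : EReal) < R → HasDerivAt (deriv u) (-f (u r)) r := by
    intro r hr hrR
    rw [← hode' r hr hrR]
    refine DifferentiableAt.hasDerivAt ?_
    rcases hr.eq_or_lt with rfl | hr
    · refine differentiableAt_of_deriv_ne_zero ?_
      rw [hode' 0 le_rfl hrR, hu0]
      linarith
    · exact (huT.2.2.differentiableOn one_ne_zero).differentiableAt
        (hTopen.mem_nhds ⟨hr, hrR⟩)
  have hneg : ∀ r : ℝ, 0 < r → (r : EReal) < R → deriv u r < 0 := fun r hr hrR =>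
    velocity_neg hP (by rwa [hu0]) (by rwa [hu0])
      (hu.continuousOn.mono fun s hs => ⟨hs.1, hlower hs.2 hrR⟩)
      (fun s hs => hd s hs.1 (hlower hs.2 hrR)) (fun s hs => hdd s hs.1 (hlower hs.2 hrR)) hu'0 hr
  have hanti : StrictAntiOn u {r : ℝ | 0 ≤ r ∧ (r : EReal) < R} := by
    have hord : OrdConnected {r : ℝ | 0 ≤ r ∧ (r : EReal) < R} :=
      ordConnected_iff.2 fun x hx y hy _ z hz => ⟨hx.1.trans hz.1, hlower hz.2 hy.2⟩
    have hconv : Convex ℝ {r : ℝ | 0 ≤ r ∧ (r : EReal) < R} := hord.convex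
    refine strictAntiOn_of_deriv_neg hconv hu.continuousOn fun r hr => ?_
    have hr0 : r ∈ interior (Ici (0 : ℝ)) := interior_mono (fun s hs => hs.1) hr
    rw [interior_Ici] at hr0
    exact hneg r hr0 (interior_subset hr).2
  have hltξ : ∀ r : ℝ, 0 < r → (r : EReal) < R → u r < ξ := fun r hr hrR => by
    rw [← hu0]
    exact hanti ⟨le_rfl, hR⟩ ⟨hr.le, hrR⟩ hr
  have hvel : ∀ r : ℝ, 0 < r → (r : EReal) < R → deriv u r = -√(2 * (P ξ - P (u r))) := by
    intro r hr hrR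
    have hE := energy_eq hP
      (hu.continuousOn.mono fun s hs => ⟨hs.1, hlower hs.2 hrR⟩)
      (fun s hs => hd s hs.1 (hlower hs.2 hrR)) (fun s hs => hdd s hs.1 (hlower hs.2 hrR)) hu'0 hr
    rw [hu0] at hE
    rw [show 2 * (P ξ - P (u r)) = deriv u r ^ 2 by linarith, Real.sqrt_sq_eq_abs,
      abs_of_neg (hneg r hr hrR), neg_neg]
  refine ⟨hanti.mono fun r hr => ⟨hr.1.le, hr.2⟩, ?_⟩
  suffices hunb : ∀ b : ℝ, ∃ r : ℝ, 0 < r ∧ (r : EReal) < R ∧ u r ≤ b by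
    refine tendsto_atBot.2 fun b => ?_
    obtain ⟨r, hr, hrR, hrb⟩ := hunb b
    filter_upwards [preimage_mem_comap (Ioo_mem_nhdsLT hrR)] with s hs
    have hrs : r < s := EReal.coe_lt_coe_iff.1 hs.1
    exact (hanti ⟨hr.le, hrR⟩ ⟨(hr.trans hrs).le, hs.2⟩ hrs).le.trans hrb
  by_contra! hbdd
  obtain ⟨b, hb⟩ := hbdd
  induction R with
  | bot => exact absurd hR not_lt_bot
  | top =>
    have hu1 : u 1 < ξ := hltξ 1 one_pos (EReal.coe_lt_top _)
    obtain ⟨m, hm, hmax'⟩ := isCompact_Icc.exists_isMaxOn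
      (nonempty_Icc.2 (hb 1 one_pos (EReal.coe_lt_top _)).le) (hPc.continuousOn (s := Icc b (u 1)))
    set c := √(2 * (P ξ - P m)) with hc
    have hcpos : 0 < c := Real.sqrt_pos.2 (by linarith [hlt m (hm.2.trans_lt hu1)])
    have hle := (convex_Ici (1 : ℝ)).image_sub_le_mul_sub_of_deriv_le (f := u) (C := -c)
      (hu.continuousOn.mono fun s (hs : 1 ≤ s) => ⟨zero_le_one.trans hs, EReal.coe_lt_top _⟩)
      (fun s hs => by
        rw [interior_Ici] at hs
        exact (hd s (one_pos.trans hs) (EReal.coe_lt_top _)).differentiableAt.differentiableWithinAt)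
      (fun s hs => by
        rw [interior_Ici] at hs
        have hs0 : 0 < s := one_pos.trans hs
        rw [hvel s hs0 (EReal.coe_lt_top _)]
        refine neg_le_neg (Real.sqrt_le_sqrt ?_)
        have hmem : u s ∈ Icc b (u 1) := ⟨(hb s hs0 (EReal.coe_lt_top _)).le,
          (hanti ⟨zero_le_one, EReal.coe_lt_top _⟩ ⟨hs0.le, EReal.coe_lt_top _⟩ hs).le⟩
        have h : P (u s) ≤ P m := hmax' hmem
        linarith)
    have hT : 0 ≤ (u 1 - b) / c :=
      div_nonneg (by linarith [hb 1 one_pos (EReal.coe_lt_top _)]) hcpos.le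
    have h1 := hle 1 self_mem_Ici (1 + (u 1 - b) / c) (by simpa using hT) (by linarith)
    have h2 := hb (1 + (u 1 - b) / c) (by linarith) (EReal.coe_lt_top _)
    rw [add_sub_cancel_left, neg_mul, mul_div_cancel₀ _ hcpos.ne'] at h1
    linarith
  | coe ρ =>
    have hρ : 0 < ρ := by exact_mod_cast hR
    have hIoo : ∀ r ∈ Ioo 0 ρ, ((r : ℝ) : EReal) < ρ := fun r hr => EReal.coe_lt_coe_iff.2 hr.2
    obtain ⟨L, hL⟩ : ∃ L, Tendsto u (𝓝[<] ρ) (𝓝 L) := by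
      have h : Tendsto (fun r => -u r) (𝓝[<] ρ) (𝓝 (sSup ((fun r => -u r) '' Ioo 0 ρ))) := by
        refine MonotoneOn.tendsto_nhdsWithin_Ioo_left (nonempty_Ioo.2 hρ) ?_ ⟨-b, ?_⟩
        · intro r hr s hs hrs
          exact neg_le_neg (hanti.antitoneOn ⟨hr.1.le, hIoo r hr⟩ ⟨hs.1.le, hIoo s hs⟩ hrs)
        · rintro _ ⟨r, hr, rfl⟩
          exact neg_le_neg (hb r hr.1 (hIoo r hr)).le
      exact ⟨_, by simpa using h.neg⟩
    have hhalf : ρ / 2 ∈ Ioo 0 ρ := ⟨by linarith, by linarith⟩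
    have hLξ : L < ξ := by
      refine lt_of_le_of_lt (le_of_tendsto hL ?_) (hltξ (ρ / 2) hhalf.1 (hIoo _ hhalf))
      filter_upwards [Ioo_mem_nhdsLT hhalf.2] with r hr
      have hr' : r ∈ Ioo 0 ρ := ⟨hhalf.1.trans hr.1, hr.2⟩
      exact (hanti ⟨hhalf.1.le, hIoo _ hhalf⟩ ⟨hr'.1.le, hIoo r hr'⟩ hr.1).le
    have hP1 : ContDiff ℝ 1 P := by
      rw [contDiff_one_iff_deriv]
      exact ⟨fun t => (hP t).differentiableAt, by
        rwa [show deriv P = f from funext fun t => (hP t).deriv]⟩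
    have hφ : ContDiffAt ℝ 1 (fun t => -√(2 * (P ξ - P t))) L := by
      have hne : 2 * (P ξ - P L) ≠ 0 := by linarith [hlt L hLξ]
      exact ((contDiffAt_const.mul (contDiffAt_const.sub hP1.contDiffAt)).sqrt hne).neg
    obtain ⟨ε, hε, v, hvu, hvξ, hv⟩ := exists_extension_of_tendsto hρ
      (fun r hr => by
        have h := hd r hr.1 (hIoo r hr)
        rwa [hvel r hr.1 (hIoo r hr)] at h) hL hφ (Iio_mem_nhds hLξ)
    have hvlt : ∀ r ∈ Ioo 0 (ρ + ε), v r < ξ := by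
      intro r hr
      rcases lt_or_ge r ρ with h | h
      · rw [hvu r h]
        exact hltξ r hr.1 (EReal.coe_lt_coe_iff.2 h)
      · exact hvξ r ⟨h, hr.2⟩
    obtain ⟨hv2, hvdd⟩ := contDiffOn_two_of_hasDerivAt_neg_sqrt isOpen_Ioo hP hfc
      (fun r hr => hlt _ (hvlt r hr)) hv
    have hev : ∀ r < ρ, v =ᶠ[𝓝 r] u := fun r hr => by
      filter_upwards [Iio_mem_nhds hr] with s hs using hvu s hs
    refine hmax ⟨((ρ + ε : ℝ) : EReal), v, ?_, ?_, ?_, ?_, ?_, ?_⟩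
    · exact EReal.coe_lt_coe_iff.2 (by linarith)
    · rintro r ⟨hr0, hr⟩
      have hr : r < ρ + ε := EReal.coe_lt_coe_iff.1 hr
      rcases hr0.eq_or_lt with rfl | hr0
      · have h := (hu 0 ⟨le_rfl, hR⟩).congr_of_eventuallyEq
          ((hev 0 hρ).filter_mono nhdsWithin_le_nhds) (hvu 0 hρ)
        refine h.mono_of_mem_nhdsWithin ?_
        filter_upwards [self_mem_nhdsWithin, mem_nhdsWithin_of_mem_nhds ((hopen ρ).mem_nhds hR)]
          with s hs hsρ using ⟨hs.1, hsρ⟩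
      · exact (hv2.contDiffAt (Ioo_mem_nhds hr0 hr)).contDiffWithinAt
    · intro r hr0 hr
      have hr : r < ρ + ε := EReal.coe_lt_coe_iff.1 hr
      rcases lt_or_ge r ρ with h | h
      · rw [(hev r h).deriv.deriv_eq, hvu r h]
        exact hode r hr0 (EReal.coe_lt_coe_iff.2 h)
      · exact (pucci_add_eq_zero_iff hlam hLam _ _).2 (hvdd r ⟨hρ.trans_le h, hr⟩)
    · rw [hvu 0 hρ, hu0]
    · rw [(hev 0 hρ).deriv_eq, hu'0]
    · exact fun r _ hr => hvu r (EReal.coe_lt_coe_iff.1 hr)
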